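/- For complex parameters a, b, c, a' with c, c+1, c+2, a'+1, a'+2 not nonpositive integers, the identity Ξ₁₀[a,b;a' | c; a'+1; σ,ρ] − (ab/(c(c+1))) σ · Ξ₁₀[a+1,b+1;a' | c+2; a'+1; σ,ρ] − ((a'−c)/(c(c+1)(a'+1))) ρ · Ξ₁₀[a,b;a'+1 | c+2; a'+2; σ,ρ] = Ξ₂(a,b;c+1;σ,ρ) holds as an identity of formal power series (equivalently, coefficientwise for each monomial σ^m ρ^k). -/

import Mathlib

open Complex

/-- Pochhammer symbol `(a)_n = a(a+1)⋯(a+n-1)` for complex `a`. -/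
noncomputable def poch (a : ℂ) (n : ℕ) : ℂ := (ascPochhammer ℂ n).eval a

/-- `c` is not a nonpositive integer `0, -1, -2, …`. -/
def notNonposInt (c : ℂ) : Prop := ∀ n : ℕ, c ≠ -(n : ℂ)

/-- Confluent hypergeometric series `Ξ₂(a,b;c;σ,ρ)`. -/
noncomputable def Xi2 (a b c σ ρ : ℂ) : ℂ :=
  ∑' mk : ℕ × ℕ, poch a mk.1 * poch b mk.1 /
    ((mk.1.factorial : ℂ) * (mk.2.factorial : ℂ) * poch c (mk.1 + mk.2)) * σ ^ mk.1 * ρ ^ mk.2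

/-- Series `Ξ₁₀[a,b;a' | c; c'; σ,ρ]`. -/
noncomputable def Xi10 (a b a' c c' σ ρ : ℂ) : ℂ :=
  ∑' mk : ℕ × ℕ, poch a mk.1 * poch b mk.1 * poch a' mk.2 /
    ((mk.1.factorial : ℂ) * (mk.2.factorial : ℂ) * poch c (mk.1 + mk.2) * poch c' mk.2) *
    σ ^ mk.1 * ρ ^ mk.2

/-- Triple hypergeometric series `Φ[a,b,c,d;e;σ,ω,ρ]`. -/
noncomputable def Phi3 (a b c d e σ ω ρ : ℂ) : ℂ :=
  ∑' t : ℕ × ℕ × ℕ, poch a t.1 * poch b t.2.1 * poch c t.1 * poch d t.2.1 /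
    ((t.1.factorial : ℂ) * (t.2.1.factorial : ℂ) * (t.2.2.factorial : ℂ) *
      poch e (t.1 + t.2.1 + t.2.2)) *
    σ ^ t.1 * ω ^ t.2.1 * ρ ^ t.2.2

/-- Gauss hypergeometric series `F(a,b;c;θ)`. -/
noncomputable def GaussF (a b c θ : ℂ) : ℂ :=
  ∑' n : ℕ, poch a n * poch b n / ((n.factorial : ℂ) * poch c n) * θ ^ n

/-- Series `Ξ_{pq}[a,b;a',b' | c; c',d'; σ,ρ]`, `p, q ∈ {0,1}`. -/
noncomputable def XiPQ (p q : ℕ) (a b a' b' c c' d' σ ρ : ℂ) : ℂ :=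
  ∑' mk : ℕ × ℕ, poch a mk.1 * poch b mk.1 * poch a' (p * mk.2) * poch b' (q * (mk.1 + mk.2)) /
    ((mk.1.factorial : ℂ) * (mk.2.factorial : ℂ) * poch c (mk.1 + mk.2) *
      poch c' (p * mk.2) * poch d' (q * (mk.1 + mk.2))) *
    σ ^ mk.1 * ρ ^ mk.2

/-- Series `Ψ_{pq}[a,b,c,d;a',b' | e; c',d'; σ,θ,ρ]`, `p, q ∈ {0,1}`. -/
noncomputable def PsiPQ (p q : ℕ) (a b c d a' b' e c' d' σ θ ρ : ℂ) : ℂ :=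
  ∑' mk : ℕ × ℕ, poch a mk.1 * poch c mk.1 * poch a' (p * mk.2) * poch b' (q * (mk.1 + mk.2)) /
    ((mk.1.factorial : ℂ) * (mk.2.factorial : ℂ) * poch e (mk.1 + mk.2) *
      poch c' (p * mk.2) * poch d' (q * (mk.1 + mk.2))) *
    GaussF b (e - d + (mk.1 : ℂ) + (mk.2 : ℂ)) (e + (mk.1 : ℂ) + (mk.2 : ℂ)) θ *
    σ ^ mk.1 * ρ ^ mk.2

open Filter Topology

theorem poch_zero (a : ℂ) : poch a 0 = 1 := by simp [poch]

theorem poch_succ (a : ℂ) (n : ℕ) : poch a (n + 1) = poch a n * (a + n) := by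
  simp [poch, ascPochhammer_succ_right]

theorem poch_succ_left (a : ℂ) (n : ℕ) : poch a (n + 1) = a * poch (a + 1) n := by
  simp [poch, ascPochhammer_succ_left, Polynomial.eval_comp]

theorem notNonposInt.add_natCast_ne_zero {c : ℂ} (hc : notNonposInt c) (n : ℕ) : c + n ≠ 0 :=
  fun h => hc n (eq_neg_of_add_eq_zero_left h)

theorem notNonposInt.poch_ne_zero {c : ℂ} (hc : notNonposInt c) (n : ℕ) : poch c n ≠ 0 := by
  induction n with
  | zero => simp [poch_zero]
  | succ n ih => rw [poch_succ]; exact mul_ne_zero ih (hc.add_natCast_ne_zero n)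

/-- A positive sequence that is eventually monotone is monotone up to a constant. -/
theorem exists_forall_le_mul_add_of_eventually_le_succ (M : ℕ) (p : ℕ → ℝ) (hp : ∀ n, 0 < p n)
    (h : ∀ n ≥ M, p n ≤ p (n + 1)) : ∃ K : ℝ, ∀ m k, p m ≤ K * p (m + k) := by
  induction M generalizing p with
  | zero =>
    exact ⟨1, fun m k => by
      simpa using monotone_nat_of_le_succ (fun n => h n n.zero_le) (Nat.le_add_right m k)⟩
  | succ M ih =>
    obtain ⟨K, hK⟩ := ih (fun n => p (n + 1)) (fun n => hp _) fun n hn => h (n + 1) (by omega)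
    refine ⟨max (max 1 K) (p 0 / p 1 * K), fun m k => ?_⟩
    rcases m with _ | m
    · rcases k with _ | k
      · exact le_mul_of_one_le_left (hp _).le ((le_max_left _ _).trans (le_max_left _ _))
      · have h1 : p 1 ≤ K * p (0 + (k + 1)) := by simpa using hK 0 k
        calc p 0 = p 0 / p 1 * p 1 := (div_mul_cancel₀ _ (hp 1).ne').symm
          _ ≤ p 0 / p 1 * (K * p (0 + (k + 1))) :=
            mul_le_mul_of_nonneg_left h1 (div_pos (hp 0) (hp 1)).le
          _ = p 0 / p 1 * K * p (0 + (k + 1)) := by ring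
          _ ≤ _ := mul_le_mul_of_nonneg_right (le_max_right _ _) (hp _).le
    · have h1 : p (m + 1) ≤ K * p (m + 1 + k) := by
        simpa [Nat.add_right_comm] using hK m k
      exact h1.trans (mul_le_mul_of_nonneg_right
        ((le_max_right _ _).trans (le_max_left _ _)) (hp _).le)

theorem notNonposInt.exists_norm_poch_le {c : ℂ} (hc : notNonposInt c) :
    ∃ K : ℝ, ∀ m k, ‖poch c m‖ ≤ K * ‖poch c (m + k)‖ := by
  obtain ⟨M, hM⟩ := exists_nat_ge (1 + ‖c‖)
  refine exists_forall_le_mul_add_of_eventually_le_succ M (fun n => ‖poch c n‖)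
    (fun n => norm_pos_iff.2 (hc.poch_ne_zero n)) fun n hn => ?_
  simp only [poch_succ, norm_mul]
  refine le_mul_of_one_le_right (norm_nonneg _) ?_
  have h1 : ‖(n : ℂ)‖ ≤ ‖c + n‖ + ‖c‖ := by simpa using norm_sub_le (c + n) c
  rw [Complex.norm_natCast] at h1
  have h2 : (M : ℝ) ≤ n := Nat.cast_le.2 hn
  linarith

theorem summable_norm_of_succ_eq_mul {f q : ℕ → ℂ} {l : ℂ} (h : ∀ n, f (n + 1) = f n * q n)
    (hq : Tendsto q atTop (𝓝 l)) (hl : ‖l‖ < 1) : Summable fun n => ‖f n‖ := by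
  obtain ⟨r, hlr, hr⟩ := exists_between hl
  refine summable_of_ratio_norm_eventually_le hr ?_
  filter_upwards [hq.norm.eventually_lt_const hlr] with n hn
  rw [norm_norm, norm_norm, h, norm_mul, mul_comm]
  exact mul_le_mul_of_nonneg_right hn.le (norm_nonneg _)

theorem tendsto_add_natCast_div_add_natCast (x y : ℂ) :
    Tendsto (fun n : ℕ => (x + n) / (y + n)) atTop (𝓝 1) := by
  simpa using tendsto_add_mul_div_add_mul_atTop_nhds x y (1 : ℂ) (one_ne_zero (α := ℂ))

theorem summable_norm_gauss (a b σ : ℂ) {c : ℂ} (hc : notNonposInt c) (hσ : ‖σ‖ < 1) :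
    Summable fun m : ℕ => ‖poch a m * poch b m / ((m.factorial : ℂ) * poch c m) * σ ^ m‖ := by
  refine summable_norm_of_succ_eq_mul (l := σ)
    (q := fun m : ℕ => (a + m) / (1 + m) * ((b + m) / (c + m)) * σ) (fun m => ?_) ?_ hσ
  · have h1 := hc.poch_ne_zero m
    have h2 := hc.add_natCast_ne_zero m
    have h3 : (m.factorial : ℂ) ≠ 0 := Nat.cast_ne_zero.2 m.factorial_ne_zero
    have h4 : (1 : ℂ) + m ≠ 0 := by rw [add_comm]; exact Nat.cast_add_one_ne_zero m
    rw [poch_succ, poch_succ, poch_succ, Nat.factorial_succ, pow_succ]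
    push_cast
    rw [add_comm (m : ℂ) 1]
    field_simp
  · simpa using ((tendsto_add_natCast_div_add_natCast a 1).mul
      (tendsto_add_natCast_div_add_natCast b c)).mul_const σ

theorem summable_norm_kummer (a ρ : ℂ) {c : ℂ} (hc : notNonposInt c) :
    Summable fun k : ℕ => ‖poch a k / ((k.factorial : ℂ) * poch c k) * ρ ^ k‖ := by
  refine summable_norm_of_succ_eq_mul (l := 0)
    (q := fun k : ℕ => (a + k) / (c + k) * (1 / ((k : ℂ) + 1)) * ρ) (fun k => ?_) ?_ (by simp)
  · have h1 := hc.poch_ne_zero k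
    have h2 := hc.add_natCast_ne_zero k
    have h3 : (k.factorial : ℂ) ≠ 0 := Nat.cast_ne_zero.2 k.factorial_ne_zero
    have h4 : (k : ℂ) + 1 ≠ 0 := Nat.cast_add_one_ne_zero k
    rw [poch_succ, poch_succ, Nat.factorial_succ, pow_succ]
    push_cast
    field_simp
  · simpa using ((tendsto_add_natCast_div_add_natCast a c).mul
      (tendsto_one_div_add_atTop_nhds_zero_nat (𝕜 := ℂ))).mul_const ρ

theorem summable_Xi10 (a b a' σ ρ : ℂ) {c c' : ℂ} (hc : notNonposInt c) (hc' : notNonposInt c')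
    (hσ : ‖σ‖ < 1) :
    Summable fun mk : ℕ × ℕ => poch a mk.1 * poch b mk.1 * poch a' mk.2 /
      ((mk.1.factorial : ℂ) * (mk.2.factorial : ℂ) * poch c (mk.1 + mk.2) * poch c' mk.2) *
      σ ^ mk.1 * ρ ^ mk.2 := by
  obtain ⟨K, hK⟩ := hc.exists_norm_poch_le
  refine Summable.of_norm_bounded (((summable_norm_gauss a b σ hc hσ).mul_of_nonneg
    (summable_norm_kummer a' ρ hc') (fun _ => norm_nonneg _)
    (fun _ => norm_nonneg _)).mul_left K) fun ⟨m, k⟩ => ?_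
  have h1 := hc.poch_ne_zero m
  have h2 := hc.poch_ne_zero (m + k)
  have hle : ‖poch c m / poch c (m + k)‖ ≤ K := by
    rw [norm_div]
    exact (div_le_iff₀ (norm_pos_iff.2 h2)).2 (hK m k)
  have heq : poch a m * poch b m * poch a' k /
      ((m.factorial : ℂ) * (k.factorial : ℂ) * poch c (m + k) * poch c' k) * σ ^ m * ρ ^ k =
      poch c m / poch c (m + k) *
        ((poch a m * poch b m / ((m.factorial : ℂ) * poch c m) * σ ^ m) *
          (poch a' k / ((k.factorial : ℂ) * poch c' k) * ρ ^ k)) := by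
    have h3 := hc'.poch_ne_zero k
    have h4 : (m.factorial : ℂ) ≠ 0 := Nat.cast_ne_zero.2 m.factorial_ne_zero
    have h5 : (k.factorial : ℂ) ≠ 0 := Nat.cast_ne_zero.2 k.factorial_ne_zero
    field_simp
  dsimp only
  rw [heq, norm_mul, ← norm_mul (_ * σ ^ m)]
  exact mul_le_mul_of_nonneg_right hle (norm_nonneg _)

theorem HasSum.of_comp_succ_left {f : ℕ × ℕ → ℂ} {s : ℂ} (h0 : ∀ k, f (0, k) = 0)
    (h : HasSum (fun mk : ℕ × ℕ => f (mk.1 + 1, mk.2)) s) : HasSum f s := by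
  have hinj : Function.Injective fun mk : ℕ × ℕ => (mk.1 + 1, mk.2) := by
    rintro ⟨m, k⟩ ⟨m', k'⟩ h
    simpa using h
  refine (hinj.hasSum_iff ?_).1 h
  rintro ⟨_ | m, k⟩ hx
  · exact h0 k
  · exact absurd ⟨(m, k), rfl⟩ hx

theorem HasSum.of_comp_succ_right {f : ℕ × ℕ → ℂ} {s : ℂ} (h0 : ∀ m, f (m, 0) = 0)
    (h : HasSum (fun mk : ℕ × ℕ => f (mk.1, mk.2 + 1)) s) : HasSum f s := by
  refine (Equiv.prodComm ℕ ℕ).hasSum_iff.1 (HasSum.of_comp_succ_left (by simpa using h0) ?_)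
  exact (Equiv.prodComm ℕ ℕ).hasSum_iff.1 h

/-- Identity (11). -/
theorem xi_identity_11 (a b c a' σ ρ : ℂ)
    (hc : notNonposInt c) (hc1 : notNonposInt (c + 1)) (hc2 : notNonposInt (c + 2))
    (ha1 : notNonposInt (a' + 1)) (ha2 : notNonposInt (a' + 2)) (hσ : ‖σ‖ < 1) :
    Xi10 a b a' c (a' + 1) σ ρ
      - a * b / (c * (c + 1)) * σ * Xi10 (a + 1) (b + 1) a' (c + 2) (a' + 1) σ ρ
      - (a' - c) / (c * (c + 1) * (a' + 1)) * ρ * Xi10 a b (a' + 1) (c + 2) (a' + 2) σ ρ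
      = Xi2 a b (c + 1) σ ρ := by
  have c0 : c ≠ 0 := by simpa using hc 0
  have c1 : c + 1 ≠ 0 := by simpa using hc1.add_natCast_ne_zero 0
  have a1 : a' + 1 ≠ 0 := by simpa using ha1.add_natCast_ne_zero 0
  have pc (n : ℕ) : poch c (n + 1) = c * poch (c + 1) n := poch_succ_left c n
  have pc1 (n : ℕ) : poch (c + 1) (n + 1) = (c + 1) * poch (c + 2) n := by
    rw [poch_succ_left]; ring_nf
  have pa1 (n : ℕ) : poch (a' + 1) n * (a' + 1 + n) = (a' + 1) * poch (a' + 2) n := by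
    rw [← poch_succ, poch_succ_left]; ring_nf
  have hf (n : ℕ) : (n.factorial : ℂ) ≠ 0 := Nat.cast_ne_zero.2 n.factorial_ne_zero
  have hs (n : ℕ) : (n : ℂ) + 1 ≠ 0 := Nat.cast_add_one_ne_zero n
  have h1 := (summable_Xi10 a b a' σ ρ hc ha1 hσ).hasSum
  have h2 : HasSum (fun mk : ℕ × ℕ => mk.1 * (poch a mk.1 * poch b mk.1 * poch a' mk.2 /
      ((mk.1.factorial : ℂ) * (mk.2.factorial : ℂ) * poch c (mk.1 + mk.2 + 1) *
        poch (a' + 1) mk.2) * σ ^ mk.1 * ρ ^ mk.2))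
      (a * b / (c * (c + 1)) * σ * Xi10 (a + 1) (b + 1) a' (c + 2) (a' + 1) σ ρ) := by
    refine HasSum.of_comp_succ_left (by simp) ?_
    refine (congrArg (HasSum · _) (funext fun ⟨m, k⟩ => ?_)).mpr
      ((summable_Xi10 (a + 1) (b + 1) a' σ ρ hc2 ha1 hσ).hasSum.mul_left _)
    dsimp only
    rw [poch_succ_left a, poch_succ_left b, pc, Nat.add_right_comm m 1 k, pc1,
      Nat.factorial_succ, pow_succ]
    push_cast
    have := hs m
    have := hf m
    have := hf k
    have := hc2.poch_ne_zero (m + k)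
    have := ha1.poch_ne_zero k
    field_simp
  have h3 : HasSum (fun mk : ℕ × ℕ => (a' - c) * (mk.2 / (a' + mk.2)) *
      (poch a mk.1 * poch b mk.1 / ((mk.1.factorial : ℂ) * (mk.2.factorial : ℂ) *
        poch c (mk.1 + mk.2 + 1)) * σ ^ mk.1 * ρ ^ mk.2))
      ((a' - c) / (c * (c + 1) * (a' + 1)) * ρ *
        Xi10 a b (a' + 1) (c + 2) (a' + 2) σ ρ) := by
    refine HasSum.of_comp_succ_right (by simp) ?_
    refine (congrArg (HasSum · _) (funext fun ⟨m, k⟩ => ?_)).mpr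
      ((summable_Xi10 a b (a' + 1) σ ρ hc2 ha2 hσ).hasSum.mul_left _)
    have hp : poch (a' + 2) k = poch (a' + 1) k * (a' + 1 + k) / (a' + 1) := by
      rw [pa1]; field_simp
    dsimp only
    rw [pc, ← Nat.add_assoc m k 1, pc1, Nat.factorial_succ, pow_succ, hp]
    push_cast
    rw [add_comm (k : ℂ) 1, ← add_assoc a' 1 (k : ℂ)]
    have : (1 : ℂ) + k ≠ 0 := by rw [add_comm]; exact hs k
    have := hf m
    have := hf k
    have := hc2.poch_ne_zero (m + k)
    have := ha1.poch_ne_zero k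
    have := ha1.add_natCast_ne_zero k
    field_simp
  refine ((h1.sub h2).sub h3).tsum_eq.symm.trans (tsum_congr fun ⟨m, k⟩ => ?_)
  have := hf m
  have := hf k
  have hN := hc1.poch_ne_zero (m + k)
  have hcN := hc.add_natCast_ne_zero (m + k)
  have hpN : poch c (m + k) = c * poch (c + 1) (m + k) / (c + (m + k : ℕ)) := by
    rw [← pc, poch_succ]; field_simp
  dsimp only
  rw [pc, hpN]
  push_cast at hcN ⊢
  rcases k with _ | k
  · simp only [poch_zero, Nat.cast_zero, add_zero, Nat.factorial_zero, Nat.cast_one] at *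
    field_simp
    ring
  · have := ha1.poch_ne_zero k
    have := ha1.add_natCast_ne_zero k
    rw [poch_succ_left a', poch_succ (a' + 1)]
    push_cast at *
    rw [show a' + ((k : ℂ) + 1) = a' + 1 + k by ring]
    field_simp
    ring
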